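/- arXiv:2407.14058 — 6 statements merged into one kernel-verified Lean document; each statement's English description precedes it below -/
import Mathlib

section
/- In a binary potential-outcomes model satisfying exogeneity and monotonicity, if 0 < P(X = 1) < 1, then the probability of sufficient-and-necessary causation is identified from observational data: PNS = P(Y₁ = 1 ∧ Y₀ = 0) = P(Y = 1 | X = 1) − P(Y = 1 | X = 0). (Theorem 3.4, identifiability of C³ under exogeneity and monotonicity.) -/
open MeasureTheory

/-- Conditional probability `P(A | B) = P(A ∩ B) / P(B)` as a real number. -/
noncomputable def condP {Ω : Type*} [MeasurableSpace Ω] (P : Measure Ω) (A B : Set Ω) : ℝ :=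
  (P (A ∩ B)).toReal / (P B).toReal

/-- **Identifiability of C³ under exogeneity and monotonicity** (Theorem 3.4).
In a binary potential-outcomes model with exogeneity and monotonicity, if
`0 < P(X = 1) < 1` then `PNS = P(Y₁ = 1 ∧ Y₀ = 0) = P(Y = 1 | X = 1) − P(Y = 1 | X = 0)`. -/
theorem c3_identifiability
    {Ω : Type*} [MeasurableSpace Ω] (P : Measure Ω) [IsProbabilityMeasure P]
    (X Y0 Y1 Y : Ω → ℝ)
    (hX : Measurable X) (hY0 : Measurable Y0) (hY1 : Measurable Y1)
    (hXbin : ∀ ω, X ω = 0 ∨ X ω = 1)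
    (hY0bin : ∀ ω, Y0 ω = 0 ∨ Y0 ω = 1)
    (hY1bin : ∀ ω, Y1 ω = 0 ∨ Y1 ω = 1)
    -- consistency: the observed outcome is `Y = X·Y₁ + (1 − X)·Y₀`
    (hYdef : ∀ ω, Y ω = X ω * Y1 ω + (1 - X ω) * Y0 ω)
    -- exogeneity: `X` is independent of the pair `(Y₀, Y₁)`
    (exo : ProbabilityTheory.IndepFun X (fun ω => (Y0 ω, Y1 ω)) P)
    -- monotonicity: `P(Y₀ = 1 ∧ Y₁ = 0) = 0`
    (mono : P {ω | Y0 ω = 1 ∧ Y1 ω = 0} = 0)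
    (hXpos : 0 < P {ω | X ω = 1})
    (hXlt : P {ω | X ω = 1} < 1) :
    (P {ω | Y1 ω = 1 ∧ Y0 ω = 0}).toReal
      = condP P {ω | Y ω = 1} {ω | X ω = 1} - condP P {ω | Y ω = 1} {ω | X ω = 0} := by
  have mX1 : MeasurableSet {ω | X ω = 1} := hX (measurableSet_singleton 1)
  have m0 : MeasurableSet {ω | Y0 ω = 1} := hY0 (measurableSet_singleton 1)
  have m1 : MeasurableSet {ω | Y1 ω = 1} := hY1 (measurableSet_singleton 1)
  have i1 : ProbabilityTheory.IndepFun X Y1 P := exo.comp measurable_id measurable_snd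
  have i0 : ProbabilityTheory.IndepFun X Y0 P := exo.comp measurable_id measurable_fst
  have e1 : P ({ω | Y ω = 1} ∩ {ω | X ω = 1}) = P {ω | X ω = 1} * P {ω | Y1 ω = 1} := by
    have h := i1.measure_inter_preimage_eq_mul {1} {1}
      (measurableSet_singleton 1) (measurableSet_singleton 1)
    have hs : {ω | Y ω = 1} ∩ {ω | X ω = 1} = X ⁻¹' {1} ∩ Y1 ⁻¹' {1} := by
      ext ω
      simp only [Set.mem_inter_iff, Set.mem_ofPred_eq, Set.mem_preimage, Set.mem_singleton_iff,
        hYdef]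
      constructor
      · rintro ⟨a, b⟩
        rw [b] at a
        exact ⟨b, by linarith⟩
      · rintro ⟨a, b⟩
        rw [a, b]
        norm_num
    rw [hs]
    exact h
  have e0 : P ({ω | Y ω = 1} ∩ {ω | X ω = 0}) = P {ω | X ω = 0} * P {ω | Y0 ω = 1} := by
    have h := i0.measure_inter_preimage_eq_mul {0} {1}
      (measurableSet_singleton 0) (measurableSet_singleton 1)
    have hs : {ω | Y ω = 1} ∩ {ω | X ω = 0} = X ⁻¹' {0} ∩ Y0 ⁻¹' {1} := by
      ext ω
      simp only [Set.mem_inter_iff, Set.mem_ofPred_eq, Set.mem_preimage, Set.mem_singleton_iff,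
        hYdef]
      constructor
      · rintro ⟨a, b⟩
        rw [b] at a
        exact ⟨b, by linarith⟩
      · rintro ⟨a, b⟩
        rw [a, b]
        norm_num
    rw [hs]
    exact h
  have hX0 : P {ω | X ω = 0} ≠ 0 := by
    intro h
    have hc : {ω | X ω = 0} = {ω | X ω = 1}ᶜ := by
      ext ω
      rcases hXbin ω with a | a <;> simp [a]
    rw [hc, prob_compl_eq_zero_iff mX1] at h
    exact hXlt.ne h
  have r1 : (P {ω | X ω = 1}).toReal ≠ 0 :=
    ENNReal.toReal_ne_zero.2 ⟨hXpos.ne', measure_ne_top _ _⟩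
  have r0 : (P {ω | X ω = 0}).toReal ≠ 0 :=
    ENNReal.toReal_ne_zero.2 ⟨hX0, measure_ne_top _ _⟩
  have d1 := measureReal_inter_add_sdiff (μ := P) (s := {ω | Y1 ω = 1}) m0
  have d0 := measureReal_inter_add_sdiff (μ := P) (s := {ω | Y0 ω = 1}) m1
  have s1 : {ω | Y1 ω = 1} \ {ω | Y0 ω = 1} = {ω | Y1 ω = 1 ∧ Y0 ω = 0} := by
    ext ω
    rcases hY0bin ω with a | a <;> simp [a]
  have s0 : {ω | Y0 ω = 1} \ {ω | Y1 ω = 1} = {ω | Y0 ω = 1 ∧ Y1 ω = 0} := by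
    ext ω
    rcases hY1bin ω with a | a <;> simp [a]
  rw [s1] at d1
  rw [s0, Set.inter_comm] at d0
  simp only [measureReal_def] at d1 d0
  rw [mono, ENNReal.toReal_zero] at d0
  unfold condP
  rw [e1, e0, ENNReal.toReal_mul, ENNReal.toReal_mul, mul_div_cancel_left₀ _ r1,
    mul_div_cancel_left₀ _ r0]
  linarith
end

section
/- In a binary potential-outcomes model (consistency only, no exogeneity or monotonicity needed), one has the exact decomposition P(Y₁ = 1 ∧ X = 0 ∧ Y = 0) + P(Y₀ = 0 ∧ X = 1 ∧ Y = 1) = P(Y₁ = 1 ∧ Y₀ = 0). Consequently, if P(X = 0 ∧ Y = 0) > 0 and P(X = 1 ∧ Y = 1) > 0, the quantity C³ := P(Y₁ = 1 | X = 0, Y = 0)·P(X = 0 ∧ Y = 0) + P(Y₀ = 0 | X = 1, Y = 1)·P(X = 1 ∧ Y = 1) of Definition 3.1 equals PNS = P(Y₁ = 1 ∧ Y₀ = 0). -/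
open MeasureTheory

/-- In a binary potential-outcomes model (consistency only), one has the exact
decomposition `P(Y₁=1 ∧ X=0 ∧ Y=0) + P(Y₀=0 ∧ X=1 ∧ Y=1) = P(Y₁=1 ∧ Y₀=0)`;
consequently, if `P(X=0 ∧ Y=0) > 0` and `P(X=1 ∧ Y=1) > 0`, the quantity `C³` of
Definition 3.1, namely
`P(Y₁=1 | X=0, Y=0)·P(X=0 ∧ Y=0) + P(Y₀=0 | X=1, Y=1)·P(X=1 ∧ Y=1)`,
equals `PNS = P(Y₁=1 ∧ Y₀=0)`. -/
theorem c3_eq_pns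
    {Ω : Type*} [MeasurableSpace Ω] (P : Measure Ω) [IsProbabilityMeasure P]
    (X Y0 Y1 Y : Ω → ℝ)
    (hX : Measurable X) (hY0 : Measurable Y0) (hY1 : Measurable Y1)
    (hXbin : ∀ ω, X ω = 0 ∨ X ω = 1)
    (hY0bin : ∀ ω, Y0 ω = 0 ∨ Y0 ω = 1)
    (hY1bin : ∀ ω, Y1 ω = 0 ∨ Y1 ω = 1)
    -- consistency: the observed outcome is `Y = X·Y₁ + (1 − X)·Y₀`
    (hYdef : ∀ ω, Y ω = X ω * Y1 ω + (1 - X ω) * Y0 ω) :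
    (P {ω | Y1 ω = 1 ∧ X ω = 0 ∧ Y ω = 0} + P {ω | Y0 ω = 0 ∧ X ω = 1 ∧ Y ω = 1}
        = P {ω | Y1 ω = 1 ∧ Y0 ω = 0})
    ∧ (0 < P {ω | X ω = 0 ∧ Y ω = 0} → 0 < P {ω | X ω = 1 ∧ Y ω = 1} →
        condP P {ω | Y1 ω = 1} {ω | X ω = 0 ∧ Y ω = 0} * (P {ω | X ω = 0 ∧ Y ω = 0}).toReal
          + condP P {ω | Y0 ω = 0} {ω | X ω = 1 ∧ Y ω = 1} * (P {ω | X ω = 1 ∧ Y ω = 1}).toReal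
        = (P {ω | Y1 ω = 1 ∧ Y0 ω = 0}).toReal) := by
  have key : P {ω | Y1 ω = 1 ∧ X ω = 0 ∧ Y ω = 0} + P {ω | Y0 ω = 0 ∧ X ω = 1 ∧ Y ω = 1}
      = P {ω | Y1 ω = 1 ∧ Y0 ω = 0} := by
    have hm : MeasurableSet {ω | X ω = 0} := hX (measurableSet_singleton 0)
    rw [← measure_inter_add_sdiff {ω | Y1 ω = 1 ∧ Y0 ω = 0} hm]
    congr 2
    · ext ω
      have h := hYdef ω
      simp only [Set.mem_setOf_eq, Set.mem_inter_iff]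
      rcases hXbin ω with hx | hx <;> simp [h, hx]
    · ext ω
      have h := hYdef ω
      simp only [Set.mem_setOf_eq, Set.mem_sdiff]
      rcases hXbin ω with hx | hx <;> simp [h, hx, and_comm]
  refine ⟨key, fun h0 h1 => ?_⟩
  have e0 : (P {ω | X ω = 0 ∧ Y ω = 0}).toReal ≠ 0 :=
    (ENNReal.toReal_pos h0.ne' (measure_ne_top P _)).ne'
  have e1 : (P {ω | X ω = 1 ∧ Y ω = 1}).toReal ≠ 0 :=
    (ENNReal.toReal_pos h1.ne' (measure_ne_top P _)).ne'
  unfold condP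
  rw [div_mul_cancel₀ _ e0, div_mul_cancel₀ _ e1,
    ← ENNReal.toReal_add (measure_ne_top P _) (measure_ne_top P _), ← key]
  rfl
end

section
/- Identification of the probability of sufficiency: in a binary potential-outcomes model satisfying exogeneity and monotonicity, if P(X = 1) > 0 and P(X = 0 ∧ Y = 0) > 0, then P(Y₁ = 1 | X = 0, Y = 0) = (P(Y = 1 | X = 1) − P(Y = 1)) / P(X = 0 ∧ Y = 0). (The sufficiency formula used in the paper's Appendix B.2 examples.) -/
open MeasureTheory

/-- **Identification of the probability of sufficiency**: under exogeneity and
monotonicity, if `P(X=1) > 0` and `P(X=0 ∧ Y=0) > 0`, then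
`P(Y₁=1 | X=0, Y=0) = (P(Y=1 | X=1) − P(Y=1)) / P(X=0 ∧ Y=0)`. -/
theorem probability_of_sufficiency_identification
    {Ω : Type*} [MeasurableSpace Ω] (P : Measure Ω) [IsProbabilityMeasure P]
    (X Y0 Y1 Y : Ω → ℝ)
    (hX : Measurable X) (hY0 : Measurable Y0) (hY1 : Measurable Y1)
    (hXbin : ∀ ω, X ω = 0 ∨ X ω = 1)
    (hY0bin : ∀ ω, Y0 ω = 0 ∨ Y0 ω = 1)
    (hY1bin : ∀ ω, Y1 ω = 0 ∨ Y1 ω = 1)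
    -- consistency: the observed outcome is `Y = X·Y₁ + (1 − X)·Y₀`
    (hYdef : ∀ ω, Y ω = X ω * Y1 ω + (1 - X ω) * Y0 ω)
    -- exogeneity: `X` is independent of the pair `(Y₀, Y₁)`
    (exo : ProbabilityTheory.IndepFun X (fun ω => (Y0 ω, Y1 ω)) P)
    -- monotonicity: `P(Y₀ = 1 ∧ Y₁ = 0) = 0`
    (mono : P {ω | Y0 ω = 1 ∧ Y1 ω = 0} = 0)
    (hXpos : 0 < P {ω | X ω = 1})
    (hpos : 0 < P {ω | X ω = 0 ∧ Y ω = 0}) :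
    condP P {ω | Y1 ω = 1} {ω | X ω = 0 ∧ Y ω = 0}
      = (condP P {ω | Y ω = 1} {ω | X ω = 1} - (P {ω | Y ω = 1}).toReal)
          / (P {ω | X ω = 0 ∧ Y ω = 0}).toReal := by
  have ind : ∀ x : ℝ, ∀ T : Set (ℝ × ℝ), MeasurableSet T →
      P.real {ω | X ω = x ∧ (Y0 ω, Y1 ω) ∈ T}
        = P.real {ω | X ω = x} * P.real {ω | (Y0 ω, Y1 ω) ∈ T} := by
    intro x T hT
    have h := exo.measure_inter_preimage_eq_mul {x} T (measurableSet_singleton x) hT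
    have h2 := congrArg ENNReal.toReal h
    rw [ENNReal.toReal_mul] at h2
    exact h2
  have mX : ∀ x : ℝ, MeasurableSet {ω | X ω = x} := fun x => hX (measurableSet_singleton x)
  have m0 : ∀ x : ℝ, MeasurableSet {ω | Y0 ω = x} := fun x => hY0 (measurableSet_singleton x)
  have m1 : ∀ x : ℝ, MeasurableSet {ω | Y1 ω = x} := fun x => hY1 (measurableSet_singleton x)
  have t0 : ∀ x : ℝ, MeasurableSet {z : ℝ × ℝ | z.1 = x} :=
    fun x => measurable_fst (measurableSet_singleton x)
  have t1 : ∀ x : ℝ, MeasurableSet {z : ℝ × ℝ | z.2 = x} :=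
    fun x => measurable_snd (measurableSet_singleton x)
  have m01 : ∀ x : ℝ, MeasurableSet {ω | Y0 ω = 1 ∧ Y1 ω = x} :=
    fun x => (m0 1).inter (m1 x)
  have mX0 : MeasurableSet {ω | X ω = 0 ∧ Y0 ω = 1} := (mX 0).inter (m0 1)
  -- the product formulas given by exogeneity
  have e1 : P.real {ω | X ω = 1 ∧ Y1 ω = 1} = P.real {ω | X ω = 1} * P.real {ω | Y1 ω = 1} :=
    ind 1 _ (t1 1)
  have e2 : P.real {ω | X ω = 0 ∧ Y0 ω = 1} = P.real {ω | X ω = 0} * P.real {ω | Y0 ω = 1} :=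
    ind 0 _ (t0 1)
  have e3 : P.real {ω | X ω = 0 ∧ Y0 ω = 0 ∧ Y1 ω = 1}
      = P.real {ω | X ω = 0} * P.real {ω | Y0 ω = 0 ∧ Y1 ω = 1} :=
    ind 0 _ ((t0 0).inter (t1 1))
  -- total probability
  have hpq : P.real {ω | X ω = 0} + P.real {ω | X ω = 1} = 1 := by
    rw [← measureReal_union _ (mX 1)]
    · rw [show {ω | X ω = 0} ∪ {ω | X ω = 1} = Set.univ from Set.eq_univ_of_forall hXbin]
      exact probReal_univ
    · rw [Set.disjoint_left]
      intro ω h h'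
      simp only [Set.mem_ofPred_eq] at h h'
      linarith
  -- monotonicity
  have hb : P.real {ω | Y0 ω = 1} = P.real {ω | Y0 ω = 1 ∧ Y1 ω = 1} := by
    have mono' : P.real {ω | Y0 ω = 1 ∧ Y1 ω = 0} = 0 := by
      simp [Measure.real, mono]
    have hs : {ω | Y0 ω = 1} = {ω | Y0 ω = 1 ∧ Y1 ω = 1} ∪ {ω | Y0 ω = 1 ∧ Y1 ω = 0} := by
      ext ω
      have := hY1bin ω
      simp only [Set.mem_ofPred_eq, Set.mem_union]
      tauto
    rw [hs, measureReal_union _ (m01 0), mono', add_zero]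
    rw [Set.disjoint_left]
    rintro ω ⟨_, h⟩ ⟨_, h'⟩
    linarith
  have ha : P.real {ω | Y1 ω = 1}
      = P.real {ω | Y0 ω = 0 ∧ Y1 ω = 1} + P.real {ω | Y0 ω = 1 ∧ Y1 ω = 1} := by
    rw [← measureReal_union _ (m01 1)]
    · congr 1
      ext ω
      have := hY0bin ω
      simp only [Set.mem_ofPred_eq, Set.mem_union]
      tauto
    · rw [Set.disjoint_left]
      rintro ω ⟨h, _⟩ ⟨h', _⟩
      linarith
  -- rewriting observed events through consistency
  have hY : P.real {ω | Y ω = 1}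
      = P.real {ω | X ω = 1 ∧ Y1 ω = 1} + P.real {ω | X ω = 0 ∧ Y0 ω = 1} := by
    rw [← measureReal_union _ mX0]
    · congr 1
      ext ω
      simp only [Set.mem_ofPred_eq, Set.mem_union, hYdef]
      rcases hXbin ω with h | h <;> simp [h]
    · rw [Set.disjoint_left]
      rintro ω ⟨h, _⟩ ⟨h', _⟩
      linarith
  have s1 : {ω | Y1 ω = 1} ∩ {ω | X ω = 0 ∧ Y ω = 0}
      = {ω | X ω = 0 ∧ Y0 ω = 0 ∧ Y1 ω = 1} := by
    ext ω
    simp only [Set.mem_ofPred_eq, Set.mem_inter_iff, hYdef]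
    rcases hXbin ω with h | h <;> simp [h, and_comm]
  have s2 : {ω | Y ω = 1} ∩ {ω | X ω = 1} = {ω | X ω = 1 ∧ Y1 ω = 1} := by
    ext ω
    simp only [Set.mem_ofPred_eq, Set.mem_inter_iff, hYdef]
    rcases hXbin ω with h | h <;> simp [h]
  have hp : P.real {ω | X ω = 1} ≠ 0 :=
    (ENNReal.toReal_pos hXpos.ne' (measure_ne_top P _)).ne'
  unfold condP
  rw [s1, s2]
  simp only [← measureReal_def]
  rw [e1, mul_div_cancel_left₀ _ hp, e3, hY, e1, e2]
  congr 1
  have hq : P.real {ω | X ω = 0} = 1 - P.real {ω | X ω = 1} := by linarith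
  rw [hq, hb, ha]
  ring
end

section
/- Identification of the probability of necessity: in a binary potential-outcomes model satisfying exogeneity and monotonicity, if P(X = 0) > 0 and P(X = 1 ∧ Y = 1) > 0, then P(Y₀ = 0 | X = 1, Y = 1) = (P(Y = 1) − P(Y = 1 | X = 0)) / P(X = 1 ∧ Y = 1). (The necessity formula used in the paper's Appendix B.2 examples.) -/
open MeasureTheory

/-- **Identification of the probability of necessity**: under exogeneity and
monotonicity, if `P(X=0) > 0` and `P(X=1 ∧ Y=1) > 0`, then
`P(Y₀=0 | X=1, Y=1) = (P(Y=1) − P(Y=1 | X=0)) / P(X=1 ∧ Y=1)`. -/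
theorem probability_of_necessity_identification
    {Ω : Type*} [MeasurableSpace Ω] (P : Measure Ω) [IsProbabilityMeasure P]
    (X Y0 Y1 Y : Ω → ℝ)
    (hX : Measurable X) (hY0 : Measurable Y0) (hY1 : Measurable Y1)
    (hXbin : ∀ ω, X ω = 0 ∨ X ω = 1)
    (hY0bin : ∀ ω, Y0 ω = 0 ∨ Y0 ω = 1)
    (hY1bin : ∀ ω, Y1 ω = 0 ∨ Y1 ω = 1)
    -- consistency: the observed outcome is `Y = X·Y₁ + (1 − X)·Y₀`
    (hYdef : ∀ ω, Y ω = X ω * Y1 ω + (1 - X ω) * Y0 ω)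
    -- exogeneity: `X` is independent of the pair `(Y₀, Y₁)`
    (exo : ProbabilityTheory.IndepFun X (fun ω => (Y0 ω, Y1 ω)) P)
    -- monotonicity: `P(Y₀ = 1 ∧ Y₁ = 0) = 0`
    (mono : P {ω | Y0 ω = 1 ∧ Y1 ω = 0} = 0)
    (hXzeroPos : 0 < P {ω | X ω = 0})
    (hpos : 0 < P {ω | X ω = 1 ∧ Y ω = 1}) :
    condP P {ω | Y0 ω = 0} {ω | X ω = 1 ∧ Y ω = 1}
      = ((P {ω | Y ω = 1}).toReal - condP P {ω | Y ω = 1} {ω | X ω = 0})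
          / (P {ω | X ω = 1 ∧ Y ω = 1}).toReal := by
  have hm0 : MeasurableSet {ω | Y0 ω = 1} := hY0 (measurableSet_singleton 1)
  have hind : P ({ω | Y ω = 1} ∩ {ω | X ω = 0}) = P {ω | X ω = 0} * P {ω | Y0 ω = 1} := by
    have h := exo.measure_inter_preimage_eq_mul {0} (Prod.fst ⁻¹' {1})
      (measurableSet_singleton 0) (measurable_fst (measurableSet_singleton 1))
    have e : {ω | Y ω = 1} ∩ {ω | X ω = 0}
        = X ⁻¹' {0} ∩ (fun ω => (Y0 ω, Y1 ω)) ⁻¹' (Prod.fst ⁻¹' {1}) := by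
      ext ω
      have h1 := hYdef ω
      simp only [Set.mem_inter_iff, Set.mem_setOf_eq, Set.mem_preimage, Set.mem_singleton_iff]
      constructor
      · rintro ⟨a, b⟩
        rw [b] at h1
        exact ⟨b, by linarith⟩
      · rintro ⟨a, b⟩
        rw [a, b] at h1
        exact ⟨by linarith, a⟩
    rw [e, h]
    rfl
  have hsum : P {ω | Y ω = 1}
      = P ({ω | Y0 ω = 0} ∩ {ω | X ω = 1 ∧ Y ω = 1}) + P {ω | Y0 ω = 1} := by
    rw [← measure_union _ hm0]
    · apply measure_congr
      have hae : ∀ᵐ ω ∂P, ¬ (Y0 ω = 1 ∧ Y1 ω = 0) := by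
        rw [ae_iff]
        simpa using mono
      filter_upwards [hae] with ω hω
      apply propext
      change Y ω = 1 ↔ ((Y0 ω = 0 ∧ X ω = 1 ∧ Y ω = 1) ∨ Y0 ω = 1)
      have h1 := hYdef ω
      rcases hXbin ω with a | a <;> rcases hY0bin ω with b | b <;>
        rcases hY1bin ω with c | c <;> simp_all
    · rw [Set.disjoint_left]
      rintro ω ⟨a, -⟩ b
      simp only [Set.mem_setOf_eq] at a b
      linarith
  have hne : (P {ω | X ω = 0}).toReal ≠ 0 :=
    (ENNReal.toReal_pos hXzeroPos.ne' (measure_ne_top _ _)).ne'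
  unfold condP
  rw [hind, hsum, ENNReal.toReal_mul, mul_div_cancel_left₀ _ hne,
    ENNReal.toReal_add (measure_ne_top _ _) (measure_ne_top _ _), add_sub_cancel_right]
end

section
/- Proposition 3.10 (risk decomposition and C³ risk bound): let U, V : Ω → {0,1} be independent random variables on a probability space (U is the prediction σ(Wᵀc) from the causal representation, V the prediction σ(Wᵀc̄) from the intervened representation) and let y ∈ {0,1} be the label. Define the sufficiency risk a := P(U ≠ y), the necessity risk b := P(V = y), and the monotonicity score m := P(U = V). Then m = a(1 − b) + (1 − a)b, hence a + b = m + 2ab, and therefore the C³ risk satisfies a + b ≤ 2a + m. -/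
open MeasureTheory

/-- **Proposition 3.10 (risk decomposition and C³ risk bound)**: for independent
`{0,1}`-valued predictions `U` (from the causal representation) and `V` (from the
intervened representation) and a label `y ∈ {0,1}`, with sufficiency risk
`a = P(U ≠ y)`, necessity risk `b = P(V = y)` and monotonicity score `m = P(U = V)`,
one has `m = a(1−b) + (1−a)b`, hence `a + b = m + 2ab`, and therefore the C³ risk
satisfies `a + b ≤ 2a + m`. -/
theorem c3_risk_decomposition_and_bound
    {Ω : Type*} [MeasurableSpace Ω] (P : Measure Ω) [IsProbabilityMeasure P]
    (U V : Ω → ℝ) (hU : Measurable U) (hV : Measurable V)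
    (hUbin : ∀ ω, U ω = 0 ∨ U ω = 1)
    (hVbin : ∀ ω, V ω = 0 ∨ V ω = 1)
    (hUV : ProbabilityTheory.IndepFun U V P)
    (y : ℝ) (hy : y = 0 ∨ y = 1)
    (a b m : ℝ)
    (ha : a = (P {ω | U ω ≠ y}).toReal)
    (hb : b = (P {ω | V ω = y}).toReal)
    (hm : m = (P {ω | U ω = V ω}).toReal) :
    m = a * (1 - b) + (1 - a) * b ∧ a + b = m + 2 * a * b ∧ a + b ≤ 2 * a + m := by
  have hs : MeasurableSet ({y} : Set ℝ) := measurableSet_singleton y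
  have hUs : MeasurableSet (U ⁻¹' {y}) := hU hs
  have hVs : MeasurableSet (V ⁻¹' {y}) := hV hs
  have e1 : P.real (U ⁻¹' {y} ∩ V ⁻¹' {y}) = P.real (U ⁻¹' {y}) * P.real (V ⁻¹' {y}) := by
    simp only [Measure.real, hUV.measure_inter_preimage_eq_mul _ _ hs hs, ENNReal.toReal_mul]
  have e2 : P.real (U ⁻¹' {y}ᶜ ∩ V ⁻¹' {y}ᶜ)
      = P.real (U ⁻¹' {y}ᶜ) * P.real (V ⁻¹' {y}ᶜ) := by
    simp only [Measure.real, hUV.measure_inter_preimage_eq_mul _ _ hs.compl hs.compl,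
      ENNReal.toReal_mul]
  have hU' : P.real (U ⁻¹' {y}ᶜ) = 1 - P.real (U ⁻¹' {y}) := by
    rw [Set.preimage_compl]; exact probReal_compl_eq_one_sub hUs
  have hV' : P.real (V ⁻¹' {y}ᶜ) = 1 - P.real (V ⁻¹' {y}) := by
    rw [Set.preimage_compl]; exact probReal_compl_eq_one_sub hVs
  have ha' : a = P.real (U ⁻¹' {y}ᶜ) := ha
  have hb' : b = P.real (V ⁻¹' {y}) := hb
  have hset : {ω | U ω = V ω} = (U ⁻¹' {y}ᶜ ∩ V ⁻¹' {y}ᶜ) ∪ (U ⁻¹' {y} ∩ V ⁻¹' {y}) := by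
    ext ω
    rcases hUbin ω with h1 | h1 <;> rcases hVbin ω with h2 | h2 <;> rcases hy with h3 | h3 <;>
      simp [h1, h2, h3]
  have hm' : m = P.real (U ⁻¹' {y}ᶜ ∩ V ⁻¹' {y}ᶜ) + P.real (U ⁻¹' {y} ∩ V ⁻¹' {y}) := by
    rw [hm, hset]
    refine measureReal_union ?_ (hUs.inter hVs)
    rw [Set.disjoint_left]
    rintro ω ⟨h, _⟩ ⟨h', _⟩
    exact h h'
  have key : m = a * (1 - b) + (1 - a) * b := by
    rw [hm', e1, e2, hV', ← hb', ← ha']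
    have : P.real (U ⁻¹' {y}) = 1 - a := by linarith
    rw [this]
  have a0 : 0 ≤ a := ha' ▸ measureReal_nonneg
  have b1 : b ≤ 1 := hb' ▸ measureReal_le_one
  refine ⟨key, by rw [key]; ring, ?_⟩
  nlinarith [mul_nonneg a0 (sub_nonneg.2 b1)]
end

section
/- Theorem 4.1 (training–test risk connection, absolutely continuous case): let P (training) and Q (test) be probability measures with Q ≪ P, density g = dQ/dP, t ∈ (1,∞), L := (∫ gᵗ dP)^{1/t} < ∞. Let f, g', h : Ω → [0,1] be measurable with h ≤ 2f + g' pointwise (h the C³ risk integrand, f the sufficiency risk integrand, g' the monotonicity risk integrand, as in Proposition 3.10). Then ∫ h dQ ≤ L·( 2(∫ f dP)^{1 − 1/t} + (∫ g' dP)^{1 − 1/t} ). -/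
open MeasureTheory

lemma risk_holder_aux
    {Ω : Type*} [MeasurableSpace Ω] (P Q : Measure Ω)
    [IsProbabilityMeasure P] [IsProbabilityMeasure Q]
    (hQP : Q ≪ P) (t : ℝ) (ht : 1 < t)
    (hfin : ∫⁻ ω, (Q.rnDeriv P ω) ^ t ∂P ≠ ⊤)
    (u : Ω → ℝ) (hum : Measurable u) (hu0 : ∀ ω, 0 ≤ u ω) (hu1 : ∀ ω, u ω ≤ 1) :
    ∫ ω, u ω ∂Q ≤ ((∫⁻ ω, (Q.rnDeriv P ω) ^ t ∂P).toReal) ^ (1 / t)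
      * (∫ ω, u ω ∂P) ^ (1 - 1 / t) := by
  have ht0 : 0 < t := by linarith
  have hpq : t.HolderConjugate t.conjExponent := Real.HolderConjugate.conjExponent ht
  have hq1 : 1 < t.conjExponent := hpq.symm.lt
  have hmeas : Measurable (fun ω => (Q.rnDeriv P ω) ^ t) :=
    (Measure.measurable_rnDeriv Q P).pow_const t
  have hint : Integrable (fun ω => ((Q.rnDeriv P ω) ^ t).toReal) P :=
    integrable_toReal_of_lintegral_ne_top hmeas.aemeasurable hfin
  have hrm : AEStronglyMeasurable (fun ω => (Q.rnDeriv P ω).toReal) P :=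
    (Measure.measurable_rnDeriv Q P).ennreal_toReal.aestronglyMeasurable
  have hf : MemLp (fun ω => (Q.rnDeriv P ω).toReal) (ENNReal.ofReal t) P := by
    rw [← integrable_norm_rpow_iff hrm (by simpa using ht0) ENNReal.ofReal_ne_top]
    refine hint.congr (Filter.Eventually.of_forall fun ω => ?_)
    simp [ENNReal.toReal_ofReal ht0.le, ENNReal.toReal_rpow]
  have hg : MemLp u (ENNReal.ofReal t.conjExponent) P :=
    MemLp.of_bound hum.aestronglyMeasurable 1
      (Filter.Eventually.of_forall fun ω => by
        rw [Real.norm_of_nonneg (hu0 ω)]; exact hu1 ω)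
  have hui : Integrable u P := hg.integrable (by simpa using hq1.le)
  have key := integral_mul_le_Lp_mul_Lq_of_nonneg hpq
    (Filter.Eventually.of_forall fun ω => ENNReal.toReal_nonneg)
    (Filter.Eventually.of_forall hu0) hf hg
  rw [integral_toReal_rnDeriv_mul hQP] at key
  have e1 : ∫ ω, (Q.rnDeriv P ω).toReal ^ t ∂P = (∫⁻ ω, (Q.rnDeriv P ω) ^ t ∂P).toReal := by
    simp_rw [ENNReal.toReal_rpow]
    exact integral_toReal hmeas.aemeasurable (ae_lt_top hmeas hfin)
  have e2 : 1 / t.conjExponent = 1 - 1 / t := by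
    have := hpq.inv_add_inv_eq_one
    simp only [one_div]; linarith
  rw [e1, e2] at key
  refine key.trans ?_
  have e3 : (0 : ℝ) ≤ 1 - 1 / t := by rw [← e2]; positivity
  have hle : ∀ ω, u ω ^ t.conjExponent ≤ u ω := fun ω =>
    Real.rpow_le_self_of_le_one (hu0 ω) (hu1 ω) hq1.le
  have h0 : 0 ≤ ∫ ω, u ω ^ t.conjExponent ∂P :=
    integral_nonneg fun ω => Real.rpow_nonneg (hu0 ω) _
  refine mul_le_mul_of_nonneg_left (Real.rpow_le_rpow h0 ?_ e3) (by positivity)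
  exact integral_mono_of_nonneg (Filter.Eventually.of_forall fun ω => Real.rpow_nonneg (hu0 ω) _)
    hui (Filter.Eventually.of_forall hle)

/-- **Theorem 4.1 (training–test risk connection, absolutely continuous case)**:
with training distribution `P`, test distribution `Q ≪ P`, density `dQ/dP`,
`t ∈ (1,∞)`, `L = (∫ (dQ/dP)ᵗ dP)^{1/t} < ∞`, and pointwise risks
`f` (sufficiency), `g'` (monotonicity), `h` (C³) in `[0,1]` with `h ≤ 2f + g'`
(Proposition 3.10), one has
`∫ h dQ ≤ L·(2 (∫ f dP)^{1−1/t} + (∫ g' dP)^{1−1/t})`. -/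
theorem training_test_risk_connection
    {Ω : Type*} [MeasurableSpace Ω] (P Q : Measure Ω)
    [IsProbabilityMeasure P] [IsProbabilityMeasure Q]
    (hQP : Q ≪ P)
    (t : ℝ) (ht : 1 < t)
    (hfin : ∫⁻ ω, (Q.rnDeriv P ω) ^ t ∂P ≠ ⊤)
    (L : ℝ) (hL : L = ((∫⁻ ω, (Q.rnDeriv P ω) ^ t ∂P).toReal) ^ (1 / t))
    (f g' h : Ω → ℝ)
    (hfm : Measurable f) (hgm : Measurable g') (hhm : Measurable h)
    (hf0 : ∀ ω, 0 ≤ f ω) (hf1 : ∀ ω, f ω ≤ 1)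
    (hg0 : ∀ ω, 0 ≤ g' ω) (hg1 : ∀ ω, g' ω ≤ 1)
    (hh0 : ∀ ω, 0 ≤ h ω) (hh1 : ∀ ω, h ω ≤ 1)
    (hbound : ∀ ω, h ω ≤ 2 * f ω + g' ω) :
    ∫ ω, h ω ∂Q
      ≤ L * (2 * (∫ ω, f ω ∂P) ^ (1 - 1 / t) + (∫ ω, g' ω ∂P) ^ (1 - 1 / t)) := by
  have hi : ∀ u : Ω → ℝ, Measurable u → (∀ ω, 0 ≤ u ω) → (∀ ω, u ω ≤ 1) → Integrable u Q :=
    fun u hm h0 h1 => Integrable.of_bound hm.aestronglyMeasurable 1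
      (Filter.Eventually.of_forall fun ω => by
        rw [Real.norm_of_nonneg (h0 ω)]; exact h1 ω)
  have hfi := hi f hfm hf0 hf1
  have hgi := hi g' hgm hg0 hg1
  have h1 : ∫ ω, h ω ∂Q ≤ ∫ ω, (2 * f ω + g' ω) ∂Q :=
    integral_mono (hi h hhm hh0 hh1) ((hfi.const_mul 2).add hgi) hbound
  rw [integral_add (hfi.const_mul 2) hgi, integral_const_mul] at h1
  have h2 := risk_holder_aux P Q hQP t ht hfin f hfm hf0 hf1
  have h3 := risk_holder_aux P Q hQP t ht hfin g' hgm hg0 hg1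
  rw [← hL] at h2 h3
  linarith
end
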